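/- arXiv:2605.08859 — 2 statements merged into one kernel-verified Lean document; each statement's English description precedes it below -/
import Mathlib

section
/- Let ρ be a real number with 3/11 < ρ < 1/3 satisfying 2(12ρ − 3)·ln(3ρ) = (1 − 3ρ)(3·ln 3 − 4), and let α ∈ [3/11, ρ). For each integer n ≥ 1 define the sequence γ_n : ℕ → ℝ by γ_n(1) = 1 and, for i ≥ 1: if γ_n(i) ≥ 3α then γ_n(i+1) = (1 − 2(1−3α)/((γ_n(i) − 12α + 3)·n))·γ_n(i), and if γ_n(i) < 3α then γ_n(i+1) = (1 − 4α/(3(γ_n(i) − α)·n))·γ_n(i). Then for every constant δ with 0 < δ < ρ − α there exists a natural number n_δ such that γ_n(n) ≥ α + δ for all n ≥ n_δ. -/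
/-- The two-regime recursively defined sequence: `γ_n 1 = 1` and, for `i ≥ 1`,
if `γ_n i ≥ 3α` then `γ_n (i+1) = (1 - 2(1-3α)/((γ_n i - 12α + 3)·n))·γ_n i`,
and if `γ_n i < 3α` then `γ_n (i+1) = (1 - 4α/(3(γ_n i - α)·n))·γ_n i`. -/
noncomputable def gam2 (α : ℝ) (n : ℕ) : ℕ → ℝ
  | 0 => 1
  | 1 => 1
  | i + 2 =>
      if 3 * α ≤ gam2 α n (i + 1) then
        (1 - 2 * (1 - 3 * α) / ((gam2 α n (i + 1) - 12 * α + 3) * n)) * gam2 α n (i + 1)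
      else
        (1 - 4 * α / (3 * (gam2 α n (i + 1) - α) * n)) * gam2 α n (i + 1)


theorem log_tangent (x y : ℝ) (hx : 0 < x) (hy : 0 < y) :
    Real.log y - Real.log x ≤ (y - x) / x := by
  have h := Real.log_le_sub_one_of_pos (div_pos hy hx)
  rw [Real.log_div hy.ne' hx.ne'] at h
  have : (y - x) / x = y / x - 1 := by field_simp
  linarith

/-- Decrease of `(4u-3) ln u / (1-u)`. -/
theorem F_decr (u v : ℝ) (hu : 3 / 4 ≤ u) (huv : u < v) (hv : v < 1) :
    (4 * v - 3) * Real.log v / (1 - v) + 3 * (v - u) ≤ (4 * u - 3) * Real.log u / (1 - u) := by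
  have hu0 : 0 < u := by linarith
  have hv0 : 0 < v := by linarith
  have h1 : 0 < 1 - v := by linarith
  have h2 : 0 < 1 - u := by linarith
  have ha := log_tangent u v hu0 hv0
  have hb := Real.log_le_sub_one_of_pos hv0
  set L := -Real.log u / (1 - u) with hL
  set M := -Real.log v / (1 - v) with hM
  have hM1 : 1 ≤ M := by rw [hM, le_div_iff₀ h1]; linarith
  have hLM : L - M ≤ (v - u) / u := by
    have e : L - M = ((1 - v) * (Real.log v - Real.log u) + (v - u) * Real.log v) /
        ((1 - u) * (1 - v)) := by
      rw [hL, hM]; field_simp; ring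
    rw [e, div_le_iff₀ (mul_pos h2 h1)]
    have e2 : (v - u) / u * ((1 - u) * (1 - v)) =
        (1 - v) * ((v - u) / u) + (v - u) * (v - 1) := by field_simp; ring
    rw [e2]
    have := mul_le_mul_of_nonneg_left ha h1.le
    have := mul_le_mul_of_nonneg_left hb (sub_pos.2 huv).le
    linarith
  have e1 : (4 * v - 3) * Real.log v / (1 - v) = -(4 * v - 3) * M := by rw [hM]; ring
  have e2 : (4 * u - 3) * Real.log u / (1 - u) = -(4 * u - 3) * L := by rw [hL]; ring
  rw [e1, e2]
  have h3 : (4 * u - 3) * (L - M) ≤ (4 * u - 3) * ((v - u) / u) :=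
    mul_le_mul_of_nonneg_left hLM (by linarith)
  have h4 : (4 * u - 3) * ((v - u) / u) ≤ v - u := by
    rw [mul_div_assoc', div_le_iff₀ hu0]
    nlinarith
  nlinarith

noncomputable def Psi1 (α x : ℝ) : ℝ :=
  ((1 - x) + (12 * α - 3) * Real.log x) / (2 * (1 - 3 * α))

noncomputable def Psi2 (α x : ℝ) : ℝ :=
  Psi1 α (3 * α) + 3 / (4 * α) * (3 * α - x) + 3 / 4 * (Real.log x - Real.log (3 * α))

theorem Psi1_tangent (α x y : ℝ) (h1 : 3 / 11 ≤ α) (h2 : α < 1 / 3) (hx : 0 < x) (hy : 0 < y) :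
    Psi1 α y ≤ Psi1 α x + (x - 12 * α + 3) / (2 * (1 - 3 * α) * x) * (x - y) := by
  have h3 : 0 < 1 - 3 * α := by linarith
  have ht := log_tangent x y hx hy
  have e : Psi1 α x + (x - 12 * α + 3) / (2 * (1 - 3 * α) * x) * (x - y) - Psi1 α y
      = (12 * α - 3) * ((y - x) / x - (Real.log y - Real.log x)) / (2 * (1 - 3 * α)) := by
    unfold Psi1; field_simp; ring
  have : 0 ≤ (12 * α - 3) * ((y - x) / x - (Real.log y - Real.log x)) / (2 * (1 - 3 * α)) :=
    div_nonneg (mul_nonneg (by linarith) (by linarith)) (by linarith)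
  linarith

theorem Psi2_tangent (α x y : ℝ) (h1 : 3 / 11 ≤ α) (hx : 0 < x) (hy : 0 < y) :
    Psi2 α y ≤ Psi2 α x + 3 * (x - α) / (4 * α * x) * (x - y) := by
  have h3 : 0 < α := by linarith
  have ht := log_tangent x y hx hy
  have e : Psi2 α x + 3 * (x - α) / (4 * α * x) * (x - y) - Psi2 α y
      = 3 / 4 * ((y - x) / x - (Real.log y - Real.log x)) := by
    unfold Psi2; field_simp; ring
  linarith

theorem Psi2_gt (ρ α : ℝ)
    (hρ1 : 3 / 11 < ρ) (hρ2 : ρ < 1 / 3)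
    (hρeq : 2 * (12 * ρ - 3) * Real.log (3 * ρ) = (1 - 3 * ρ) * (3 * Real.log 3 - 4))
    (hα1 : 3 / 11 ≤ α) (hα2 : α < ρ)
    (δ : ℝ) (hδ0 : 0 < δ) (hδ : δ < ρ - α) : 1 < Psi2 α (α + δ) := by
  have hα0 : 0 < α := by linarith
  have hF := F_decr (3 * α) (3 * ρ) (by linarith) (by linarith) (by linarith)
  have e1 : (4 * (3 * ρ) - 3) * Real.log (3 * ρ) / (1 - 3 * ρ) = (3 * Real.log 3 - 4) / 2 := by
    rw [div_eq_iff (by linarith)]; linarith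
  rw [e1] at hF
  have e2 : Psi1 α (3 * α) = 1 / 2 + (4 * (3 * α) - 3) * Real.log (3 * α) / (1 - 3 * α) / 2 := by
    have : 1 - 3 * α ≠ 0 := by linarith
    unfold Psi1; field_simp; ring
  have e3 : Real.log (3 * α) = Real.log 3 + Real.log α :=
    Real.log_mul (by norm_num) hα0.ne'
  have ht := log_tangent (α + δ) α (by linarith) hα0
  have e4 : (α - (α + δ)) / (α + δ) ≤ 0 :=
    div_nonpos_of_nonpos_of_nonneg (by linarith) (by linarith)
  have e5 : 3 / (4 * α) * (3 * α - (α + δ)) = 3 / 2 - 3 / (4 * α) * δ := by field_simp; ring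
  have e6 : 3 / (4 * α) * δ ≤ 11 / 4 * δ := by
    apply mul_le_mul_of_nonneg_right _ hδ0.le
    rw [div_le_iff₀ (by linarith)]; linarith
  unfold Psi2
  rw [e5, e2]
  linarith

theorem step1 (α x n : ℝ) (h1 : 3 / 11 ≤ α) (h2 : α < 1 / 3) (hx : 3 * α ≤ x) (hx1 : x ≤ 1)
    (hn : 2 ≤ n) (y : ℝ) (hy : y = (1 - 2 * (1 - 3 * α) / ((x - 12 * α + 3) * n)) * x) :
    y ≤ x ∧ α < y ∧ (3 * α ≤ y → Psi1 α y ≤ Psi1 α x + 1 / n) ∧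
      (y < 3 * α → Psi2 α y ≤ Psi1 α x + 1 / n) := by
  have hx0 : 0 < x := by linarith
  have hD : 0 < x - 12 * α + 3 := by linarith
  have ha : 0 < 1 - 3 * α := by linarith
  have hn0 : 0 < n := by linarith
  have hα0 : 0 < α := by linarith
  have hd : x - y = 2 * (1 - 3 * α) * x / ((x - 12 * α + 3) * n) := by rw [hy]; ring
  have hd0 : 0 ≤ x - y := by rw [hd]; positivity
  have hd1 : x - y ≤ 1 / 3 := by
    rw [hd, div_le_iff₀ (by positivity)]
    have : (3 - 9 * α) * 2 ≤ (x - 12 * α + 3) * n :=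
      mul_le_mul (by linarith) hn (by norm_num) hD.le
    nlinarith
  have hyα : α < y := by linarith
  have hy0 : 0 < y := by linarith
  have hh : (x - 12 * α + 3) / (2 * (1 - 3 * α) * x) * (x - y) = 1 / n := by
    rw [hd]
    generalize 1 - 3 * α = a at ha
    generalize x - 12 * α + 3 = D at hD
    field_simp
  refine ⟨by linarith, hyα, fun _ => ?_, fun h => ?_⟩
  · have := Psi1_tangent α x y h1 h2 hx0 hy0
    linarith
  · have t1 := Psi1_tangent α x (3 * α) h1 h2 hx0 (by linarith)
    have t2 := Psi2_tangent α (3 * α) y h1 (by linarith) hy0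
    have e : Psi2 α (3 * α) = Psi1 α (3 * α) := by unfold Psi2; ring
    have c : 3 * (3 * α - α) / (4 * α * (3 * α)) ≤ (x - 12 * α + 3) / (2 * (1 - 3 * α) * x) := by
      rw [div_le_div_iff₀ (by positivity) (by positivity)]
      have : 0 ≤ α * ((12 * α - 3) * (x - 3 * α)) :=
        mul_nonneg hα0.le (mul_nonneg (by linarith) (by linarith))
      nlinarith
    have c2 := mul_le_mul_of_nonneg_right c (show 0 ≤ 3 * α - y by linarith)
    have : (x - 12 * α + 3) / (2 * (1 - 3 * α) * x) * (x - y) =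
      (x - 12 * α + 3) / (2 * (1 - 3 * α) * x) * (x - 3 * α) +
      (x - 12 * α + 3) / (2 * (1 - 3 * α) * x) * (3 * α - y) := by ring
    linarith

theorem step2 (α δ x n : ℝ) (h1 : 3 / 11 ≤ α) (h2 : α < 1 / 3) (hδ0 : 0 < δ) (hx : x < 3 * α)
    (hx1 : α + δ ≤ x) (hn0 : 0 < n)
    (hn : 1 < n * δ ^ 2) (y : ℝ) (hy : y = (1 - 4 * α / (3 * (x - α) * n)) * x) :
    y ≤ x ∧ α < y ∧ Psi2 α y ≤ Psi2 α x + 1 / n := by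
  have hα0 : 0 < α := by linarith
  have hx0 : 0 < x := by linarith
  have hD : 0 < x - α := by linarith
  have hd : x - y = 4 * α * x / (3 * (x - α) * n) := by rw [hy]; ring
  have hd0 : 0 ≤ x - y := by rw [hd]; positivity
  have hd1 : x - y < δ := by
    rw [hd, div_lt_iff₀ (by positivity)]
    have a1 : α * x < 1 / 3 * 1 := mul_lt_mul h2 (by linarith) hx0 (by norm_num)
    have a2 : n * δ * δ ≤ n * δ * (x - α) :=
      mul_le_mul_of_nonneg_left (by linarith) (by positivity)
    nlinarith
  have hyα : α < y := by linarith
  refine ⟨by linarith, hyα, ?_⟩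
  have t := Psi2_tangent α x y h1 hx0 (by linarith)
  have hh : 3 * (x - α) / (4 * α * x) * (x - y) = 1 / n := by
    rw [hd]; field_simp
  linarith

/-- For `ρ ∈ (3/11, 1/3)` solving `2(12ρ-3)·ln(3ρ) = (1-3ρ)(3·ln 3 - 4)` and
`α ∈ [3/11, ρ)`, for every `0 < δ < ρ - α` there is `n_δ` such that
`γ_n(n) ≥ α + δ` for all `n ≥ n_δ`. -/
theorem gam2_eventually_ge (ρ α : ℝ)
    (hρ1 : 3 / 11 < ρ) (hρ2 : ρ < 1 / 3)
    (hρeq : 2 * (12 * ρ - 3) * Real.log (3 * ρ) = (1 - 3 * ρ) * (3 * Real.log 3 - 4))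
    (hα1 : 3 / 11 ≤ α) (hα2 : α < ρ)
    (δ : ℝ) (hδ0 : 0 < δ) (hδ : δ < ρ - α) :
    ∃ nδ : ℕ, ∀ n : ℕ, nδ ≤ n → α + δ ≤ gam2 α n n := by
  have hP := Psi2_gt ρ α hρ1 hρ2 hρeq hα1 hα2 δ hδ0 hδ
  have hα3 : α < 1 / 3 := by linarith
  obtain ⟨N, hN⟩ := exists_nat_gt (1 / δ ^ 2)
  refine ⟨max 2 N, fun n hn => ?_⟩
  have hn2 : 2 ≤ n := le_trans (le_max_left _ _) hn
  have hn2' : (2 : ℝ) ≤ n := by exact_mod_cast hn2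
  have hnN : (N : ℝ) ≤ n := by exact_mod_cast le_trans (le_max_right _ _) hn
  have hn0 : (0 : ℝ) < n := by linarith
  have hnδ : 1 < (n : ℝ) * δ ^ 2 := by
    rw [← div_lt_iff₀ (by positivity)]; linarith
  have key : ∀ y : ℝ, α < y → Psi2 α y ≤ 1 → α + δ ≤ y := by
    intro y hy hy1
    by_contra hc
    push Not at hc
    have t := Psi2_tangent α y (α + δ) hα1 (by linarith) (by linarith)
    have : 3 * (y - α) / (4 * α * y) * (y - (α + δ)) ≤ 0 := by
      apply mul_nonpos_of_nonneg_of_nonpos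
      · apply div_nonneg
        · linarith
        · have : 0 < α * y := mul_pos (by linarith) (by linarith)
          linarith
      · linarith
    linarith
  have main : ∀ k : ℕ, k + 1 ≤ n → α + δ ≤ gam2 α n (k + 1) ∧ gam2 α n (k + 1) ≤ 1 ∧
      ((3 * α ≤ gam2 α n (k + 1) ∧ Psi1 α (gam2 α n (k + 1)) ≤ k / n) ∨
       (gam2 α n (k + 1) < 3 * α ∧ Psi2 α (gam2 α n (k + 1)) ≤ k / n)) := by
    intro k
    induction k with
    | zero =>
      intro _
      have e : gam2 α n (0 + 1) = 1 := by simp [gam2]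
      rw [e]
      refine ⟨by linarith, le_refl _, Or.inl ⟨by linarith, ?_⟩⟩
      simp [Psi1]
    | succ k ih =>
      intro hk
      obtain ⟨hlo, hhi, hor⟩ := ih (by omega)
      have hk1 : ((k + 1 : ℕ) : ℝ) / n ≤ 1 := by
        rw [div_le_one hn0]; exact_mod_cast (by omega : k + 1 ≤ n)
      have hk2 : ((k + 1 : ℕ) : ℝ) / n = k / n + 1 / n := by push_cast; ring
      rcases hor with ⟨hc, hps⟩ | ⟨hc, hps⟩
      · obtain ⟨s1, s2, s3, s4⟩ := step1 α _ n hα1 hα3 hc hhi hn2' (gam2 α n (k + 1 + 1))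
          (by rw [gam2, if_pos hc])
        rcases le_or_gt (3 * α) (gam2 α n (k + 1 + 1)) with h | h
        · have := s3 h
          exact ⟨by linarith, by linarith, Or.inl ⟨h, by linarith⟩⟩
        · have := s4 h
          exact ⟨key _ s2 (by linarith), by linarith, Or.inr ⟨h, by linarith⟩⟩
      · obtain ⟨s1, s2, s3⟩ := step2 α δ _ n hα1 hα3 hδ0 hc hlo hn0 hnδ (gam2 α n (k + 1 + 1))
          (by rw [gam2, if_neg (not_le.2 hc)])
        exact ⟨key _ s2 (by linarith), by linarith, Or.inr ⟨by linarith, by linarith⟩⟩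
  have := (main (n - 1) (by omega)).1
  rwa [Nat.sub_add_cancel (by omega)] at this
end

section
/- Let ε be a real number with 0 < ε ≤ 1/240, let n ≥ 1, and let G be a bipartite graph with finite vertex sides U and W, where |U| = n and |W| ≥ n. Then at least one of the following holds: (1) G has a matching saturating all of U; (2) G has a maximal matching with at most (1 − ε)n edges; (3) there are partitions U = U_1 ⊔ U_2 and W = W_1 ⊔ W_2 such that |U_1| = |W_1|, some perfect matching between U_1 and W_1 is a maximal matching of G, and every vertex u ∈ U_2 satisfies |N(u)| ≤ n − 3|U_2|; (4) there are partitions U = U_1 ⊔ U_2 ⊔ U_3 and W = W_1 ⊔ W_2 ⊔ W_3 such that (a) |U_1| = |W_1| and there is a perfect matching between U_1 and W_1, (b) G has no edges between U_2 and W_3 and no edges between U_3 and W_2 ∪ W_3, (c) (1 − 60ε)n ≤ |W_2| < |U_2|, and (d) for every subset U_2' ⊆ U_2 with |U_2'| = |W_2| there is a perfect matching between U_2' and W_2. -/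
open Finset

/-- `Mch` is a matching in the bipartite graph with edge set `E ⊆ U × W`:
a set of edges no two of which share an endpoint. -/
def IsMatching {U W : Type} (E Mch : Finset (U × W)) : Prop :=
  Mch ⊆ E ∧
  (∀ p ∈ Mch, ∀ q ∈ Mch, p.1 = q.1 → p = q) ∧
  (∀ p ∈ Mch, ∀ q ∈ Mch, p.2 = q.2 → p = q)

/-- `Mch` is a maximal matching: a matching not properly contained in another matching. -/
def IsMaximalMatching {U W : Type} (E Mch : Finset (U × W)) : Prop :=
  IsMatching E Mch ∧ ∀ Mch' : Finset (U × W), IsMatching E Mch' → Mch ⊆ Mch' → Mch' = Mch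

/-- `Mch` is a perfect matching between `A ⊆ U` and `B ⊆ W`: a matching whose set of
saturated vertices is exactly `A ∪ B`. -/
def IsPerfectMatchingBetween {U W : Type} (E : Finset (U × W))
    (A : Finset U) (B : Finset W) (Mch : Finset (U × W)) : Prop :=
  IsMatching E Mch ∧
  (∀ p ∈ Mch, p.1 ∈ A ∧ p.2 ∈ B) ∧
  (∀ u ∈ A, ∃ w, (u, w) ∈ Mch) ∧
  (∀ w ∈ B, ∃ u, (u, w) ∈ Mch)

theorem exists_maximal_ext {U W : Type} [Fintype U] [Fintype W]
    (E M : Finset (U × W)) (h : IsMatching E M) :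
    ∃ M', IsMaximalMatching E M' ∧ M ⊆ M' := by
  obtain ⟨M', hM', hmax⟩ := (Set.toFinite {X : Finset (U × W) | IsMatching E X}).exists_le_maximal h
  refine ⟨M', ⟨hmax.prop, fun X hX hs => ?_⟩, hM'⟩
  exact subset_antisymm (hmax.le_of_ge hX hs) hs

theorem maximal_no_edge {U W : Type} [DecidableEq U] [DecidableEq W]
    (E M : Finset (U × W)) (h : IsMaximalMatching E M) (u : U) (w : W)
    (hu : ∀ w', (u, w') ∉ M) (hw : ∀ u', (u', w) ∉ M) : (u, w) ∉ E := by
  intro he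
  have hm : IsMatching E (insert (u, w) M) := by
    obtain ⟨⟨h1, h2, h3⟩, -⟩ := h
    refine ⟨Finset.insert_subset he h1, ?_, ?_⟩
    · rintro ⟨a, b⟩ hp ⟨c, d⟩ hq hac
      grind
    · rintro ⟨a, b⟩ hp ⟨c, d⟩ hq hac
      grind
  have := h.2 _ hm (Finset.subset_insert _ _)
  have h4 : (u, w) ∈ M := by rw [← this]; exact Finset.mem_insert_self _ _
  exact hu w h4

theorem hall_matching {U W : Type} [DecidableEq U] [DecidableEq W]
    (E : Finset (U × W)) (A : Finset U) (t : U → Finset W)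
    (ht : ∀ u ∈ A, ∀ w ∈ t u, (u, w) ∈ E)
    (h : ∀ S ⊆ A, S.card ≤ (S.biUnion t).card) :
    ∃ M, IsMatching E M ∧ (∀ p ∈ M, p.1 ∈ A ∧ p.2 ∈ t p.1) ∧ (∀ u ∈ A, ∃ w, (u, w) ∈ M) ∧
      M.card = A.card := by
  have h' : ∀ s : Finset A, s.card ≤ (s.biUnion (fun a => t a.1)).card := by
    intro s
    have := h (s.image Subtype.val) (by intro x hx; grind)
    rw [Finset.card_image_of_injective _ Subtype.val_injective, Finset.image_biUnion] at this
    exact this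
  obtain ⟨f, hf, hft⟩ := (Finset.all_card_le_biUnion_card_iff_exists_injective _).1 h'
  refine ⟨A.attach.image (fun a => (a.1, f a)), ⟨?_, ?_, ?_⟩, ?_, ?_, ?_⟩
  · intro p hp
    obtain ⟨a, -, rfl⟩ := Finset.mem_image.1 hp
    exact ht _ a.2 _ (hft a)
  · intro p hp q hq hpq
    obtain ⟨a, -, rfl⟩ := Finset.mem_image.1 hp
    obtain ⟨b, -, rfl⟩ := Finset.mem_image.1 hq
    have : a = b := Subtype.ext hpq
    rw [this]
  · intro p hp q hq hpq
    obtain ⟨a, -, rfl⟩ := Finset.mem_image.1 hp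
    obtain ⟨b, -, rfl⟩ := Finset.mem_image.1 hq
    have : a = b := hf hpq
    rw [this]
  · intro p hp
    obtain ⟨a, -, rfl⟩ := Finset.mem_image.1 hp
    exact ⟨a.2, hft a⟩
  · intro u hu
    exact ⟨f ⟨u, hu⟩, Finset.mem_image.2 ⟨⟨u, hu⟩, Finset.mem_attach _ _, rfl⟩⟩
  · rw [Finset.card_image_of_injective, Finset.card_attach]
    intro a b hab
    exact Subtype.ext (Prod.ext_iff.1 hab).1

theorem matching_card_fst {U W : Type} [DecidableEq U] (E M : Finset (U × W))
    (h : IsMatching E M) : (M.image Prod.fst).card = M.card :=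
  Finset.card_image_of_injOn (fun p hp q hq => h.2.1 p hp q hq)

theorem matching_card_snd {U W : Type} [DecidableEq W] (E M : Finset (U × W))
    (h : IsMatching E M) : (M.image Prod.snd).card = M.card :=
  Finset.card_image_of_injOn (fun p hp q hq => h.2.2 p hp q hq)

theorem matching_perfect {U W : Type} [DecidableEq U] [DecidableEq W] (E M : Finset (U × W))
    (h : IsMatching E M) :
    IsPerfectMatchingBetween E (M.image Prod.fst) (M.image Prod.snd) M := by
  refine ⟨h, fun p hp => ⟨Finset.mem_image_of_mem _ hp, Finset.mem_image_of_mem _ hp⟩, ?_, ?_⟩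
  · intro u hu
    obtain ⟨⟨a, b⟩, hp, rfl⟩ := Finset.mem_image.1 hu
    exact ⟨b, hp⟩
  · intro w hw
    obtain ⟨⟨a, b⟩, hp, rfl⟩ := Finset.mem_image.1 hw
    exact ⟨a, hp⟩

/-- A dense bipartite graph between sets of equal size has a perfect matching. -/
theorem dense_perfect {U W : Type} [DecidableEq U] [DecidableEq W]
    (E : Finset (U × W)) (A : Finset U) (B : Finset W) (hAB : A.card = B.card) (x y : ℝ)
    (hxy : x + y < B.card)
    (hA : ∀ u ∈ A, ((B.filter (fun w => (u, w) ∉ E)).card : ℝ) ≤ x)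
    (hB : ∀ w ∈ B, ((A.filter (fun u => (u, w) ∉ E)).card : ℝ) ≤ y) :
    ∃ M, IsPerfectMatchingBetween E A B M := by
  obtain ⟨M, hM, hM1, hM2, hMc⟩ := hall_matching E A (fun u => B.filter (fun w => (u, w) ∈ E))
    (by simp) (by
      intro S hS
      rcases S.eq_empty_or_nonempty with rfl | ⟨u, hu⟩
      · simp
      by_cases hy : (S.card : ℝ) ≤ y
      · have h1 := hA u (hS hu)
        have h2 := Finset.card_filter_add_card_filter_not (s := B) (fun w => (u, w) ∈ E)
        have h3 : (B.filter (fun w => (u, w) ∈ E)).card ≤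
            (S.biUnion (fun u => B.filter (fun w => (u, w) ∈ E))).card :=
          Finset.card_le_card (Finset.subset_biUnion_of_mem
            (fun u => B.filter (fun w => (u, w) ∈ E)) hu)
        have h2' : ((B.filter (fun w => (u, w) ∈ E)).card : ℝ) +
          ((B.filter (fun w => (u, w) ∉ E)).card : ℝ) = B.card := by exact_mod_cast h2
        have h3' : ((B.filter (fun w => (u, w) ∈ E)).card : ℝ) ≤
            ((S.biUnion (fun u => B.filter (fun w => (u, w) ∈ E))).card : ℝ) := by
          exact_mod_cast h3
        have : (S.card : ℝ) ≤
            ((S.biUnion (fun u => B.filter (fun w => (u, w) ∈ E))).card : ℝ) := by linarith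
        exact_mod_cast this
      · have : B ⊆ S.biUnion (fun u => B.filter (fun w => (u, w) ∈ E)) := by
          intro w hw
          by_contra hcon
          have h1 : S ⊆ A.filter (fun u => (u, w) ∉ E) := by
            intro v hv
            refine Finset.mem_filter.2 ⟨hS hv, fun he => hcon ?_⟩
            exact Finset.mem_biUnion.2 ⟨v, hv, Finset.mem_filter.2 ⟨hw, he⟩⟩
          have h2 : (S.card : ℝ) ≤ ((A.filter (fun u => (u, w) ∉ E)).card : ℝ) := by
            exact_mod_cast Finset.card_le_card h1
          exact hy (h2.trans (hB w hw))
        calc S.card ≤ A.card := Finset.card_le_card hS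
          _ = B.card := hAB
          _ ≤ _ := Finset.card_le_card this)
  have himg : M.image Prod.snd = B := by
    apply Finset.eq_of_subset_of_card_le
    · intro w hw
      obtain ⟨p, hp, rfl⟩ := Finset.mem_image.1 hw
      exact (Finset.mem_filter.1 (hM1 p hp).2).1
    · rw [matching_card_snd E M hM, hMc, hAB]
  refine ⟨M, hM, fun p hp => ⟨(hM1 p hp).1, (Finset.mem_filter.1 (hM1 p hp).2).1⟩, hM2, ?_⟩
  intro w hw
  rw [← himg] at hw
  obtain ⟨⟨a, b⟩, hp, rfl⟩ := Finset.mem_image.1 hw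
  exact ⟨a, hp⟩

/-- The structural alternative for bipartite graphs with `|U| = n` and `|W| ≥ n`. -/
theorem bipartite_four_cases {U W : Type} [Fintype U] [Fintype W]
    [DecidableEq U] [DecidableEq W]
    (ε : ℝ) (hε0 : 0 < ε) (hε : ε ≤ 1 / 240)
    (n : ℕ) (hn : 1 ≤ n)
    (hU : Fintype.card U = n) (hW : n ≤ Fintype.card W)
    (E : Finset (U × W)) :
    -- (1) a matching saturating all of U
    (∃ Mch, IsMatching E Mch ∧ ∀ u : U, ∃ w, (u, w) ∈ Mch) ∨
    -- (2) a maximal matching with at most (1 - ε)n edges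
    (∃ Mch, IsMaximalMatching E Mch ∧ (Mch.card : ℝ) ≤ (1 - ε) * n) ∨
    -- (3)
    (∃ (U1 U2 : Finset U) (W1 W2 : Finset W) (Mch : Finset (U × W)),
      Disjoint U1 U2 ∧ U1 ∪ U2 = Finset.univ ∧
      Disjoint W1 W2 ∧ W1 ∪ W2 = Finset.univ ∧
      U1.card = W1.card ∧
      IsPerfectMatchingBetween E U1 W1 Mch ∧ IsMaximalMatching E Mch ∧
      ∀ u ∈ U2,
        (((Finset.univ.filter (fun w => (u, w) ∈ E)).card : ℤ)
          ≤ (n : ℤ) - 3 * U2.card)) ∨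
    -- (4)
    (∃ (U1 U2 U3 : Finset U) (W1 W2 W3 : Finset W),
      Disjoint U1 U2 ∧ Disjoint U1 U3 ∧ Disjoint U2 U3 ∧
      U1 ∪ U2 ∪ U3 = Finset.univ ∧
      Disjoint W1 W2 ∧ Disjoint W1 W3 ∧ Disjoint W2 W3 ∧
      W1 ∪ W2 ∪ W3 = Finset.univ ∧
      -- (a)
      U1.card = W1.card ∧ (∃ Mch, IsPerfectMatchingBetween E U1 W1 Mch) ∧
      -- (b)
      (∀ u ∈ U2, ∀ w ∈ W3, (u, w) ∉ E) ∧
      (∀ u ∈ U3, ∀ w ∈ W2 ∪ W3, (u, w) ∉ E) ∧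
      -- (c)
      (1 - 60 * ε) * n ≤ (W2.card : ℝ) ∧ W2.card < U2.card ∧
      -- (d)
      (∀ U2' ⊆ U2, U2'.card = W2.card →
        ∃ Mch, IsPerfectMatchingBetween E U2' W2 Mch)) := by
  right
  by_cases h2 : ∃ Mch, IsMaximalMatching E Mch ∧ (Mch.card : ℝ) ≤ (1 - ε) * n
  · exact Or.inl h2
  right
  push Not at h2
  have hn0 : (1 : ℝ) ≤ n := by exact_mod_cast hn
  have hεn : 0 < ε * n := by positivity
  have hεn' : 240 * (ε * n) ≤ n := by nlinarith
  set N : U → Finset W := fun u => Finset.univ.filter (fun w => (u, w) ∈ E) with hN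
  set H : Finset U := Finset.univ.filter (fun u => (n : ℝ) - 3 * (ε * n) < ((N u).card : ℝ)) with hH
  by_cases hall : ∀ S ⊆ H, S.card ≤ (S.biUnion N).card
  · left
    obtain ⟨M0, hM0, -, hM0s, -⟩ := hall_matching E H N (by simp [hN]) hall
    obtain ⟨M, hM, hsub⟩ := exists_maximal_ext E M0 hM0
    refine ⟨M.image Prod.fst, (M.image Prod.fst)ᶜ, M.image Prod.snd, (M.image Prod.snd)ᶜ, M,
      disjoint_compl_right, Finset.union_compl _, disjoint_compl_right, Finset.union_compl _,
      ?_, matching_perfect E M hM.1, hM, ?_⟩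
    · rw [matching_card_fst E M hM.1, matching_card_snd E M hM.1]
    · intro u hu
      have hc : ((M.image Prod.fst)ᶜ.card : ℝ) + M.card = n := by
        rw [← matching_card_fst E M hM.1, ← hU, add_comm]
        exact_mod_cast Finset.card_add_card_compl _
      have hMc := h2 M hM
      have huH : u ∉ H := by
        intro huH
        obtain ⟨w, hw⟩ := hM0s u huH
        exact (Finset.mem_compl.1 hu) (Finset.mem_image.2 ⟨_, hsub hw, rfl⟩)
      have hd : ((N u).card : ℝ) ≤ (n : ℝ) - 3 * (ε * n) := by
        by_contra hcon
        exact huH (Finset.mem_filter.2 ⟨Finset.mem_univ _, not_le.1 hcon⟩)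
      have : ((N u).card : ℝ) ≤ (n : ℝ) - 3 * ((M.image Prod.fst)ᶜ.card : ℝ) := by nlinarith
      exact_mod_cast this
  right
  push Not at hall
  obtain ⟨S, hSH, hS⟩ := hall
  set Y := S.biUnion N with hY
  have hNY : ∀ u ∈ S, N u ⊆ Y := fun u hu => Finset.subset_biUnion_of_mem N hu
  have hSn : (S.card : ℝ) ≤ n := by
    rw [← hU]; exact_mod_cast Finset.card_le_univ S
  have hYS : (Y.card : ℝ) + 1 ≤ S.card := by exact_mod_cast hS
  have hdeg : ∀ u ∈ S, (n : ℝ) - 3 * (ε * n) < ((N u).card : ℝ) := fun u hu =>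
    (Finset.mem_filter.1 (hSH hu)).2
  have hYlow : (n : ℝ) - 3 * (ε * n) < Y.card := by
    have hpos : 0 < S.card := by omega
    obtain ⟨u, hu⟩ := Finset.card_pos.1 hpos
    have : ((N u).card : ℝ) ≤ Y.card := by exact_mod_cast Finset.card_le_card (hNY u hu)
    linarith [hdeg u hu]
  have hmissU : ∀ u ∈ S, ((Y.filter (fun w => (u, w) ∉ E)).card : ℝ) ≤ 3 * (ε * n) := by
    intro u hu
    have h1 := Finset.card_filter_add_card_filter_not (s := Y) (fun w => (u, w) ∈ E)
    have h3 : Y.filter (fun w => (u, w) ∈ E) = N u := by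
      ext w
      constructor
      · intro h; simpa [hN] using (Finset.mem_filter.1 h).2
      · intro h; exact Finset.mem_filter.2 ⟨hNY u hu h, by simpa [hN] using h⟩
    rw [h3] at h1
    have h1' : ((N u).card : ℝ) + ((Y.filter (fun w => (u, w) ∉ E)).card : ℝ) = Y.card := by
      exact_mod_cast h1
    linarith [hdeg u hu]
  set B := Y.filter (fun w => ¬ (((S.filter (fun u => (u, w) ∉ E)).card : ℝ) ≤ n / 4)) with hB
  set Wg := Y.filter (fun w => ((S.filter (fun u => (u, w) ∉ E)).card : ℝ) ≤ n / 4) with hWg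
  have hBW : (Wg.card : ℝ) + B.card = Y.card := by
    exact_mod_cast Finset.card_filter_add_card_filter_not (s := Y)
      (fun w => ((S.filter (fun u => (u, w) ∉ E)).card : ℝ) ≤ n / 4)
  have hBcard : (B.card : ℝ) ≤ 12 * (ε * n) := by
    have hdc := Finset.sum_card_bipartiteAbove_eq_sum_card_bipartiteBelow
      (s := S) (t := Y) (fun u w => (u, w) ∉ E)
    have hdc' : (∑ u ∈ S, ((Y.filter (fun w => (u, w) ∉ E)).card : ℝ)) =
        ∑ w ∈ Y, ((S.filter (fun u => (u, w) ∉ E)).card : ℝ) := by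
      exact_mod_cast hdc
    have h1 : (∑ u ∈ S, ((Y.filter (fun w => (u, w) ∉ E)).card : ℝ)) ≤ S.card * (3 * (ε * n)) := by
      have := Finset.sum_le_card_nsmul S _ _ hmissU
      simpa using this
    have h3 : (B.card : ℝ) * (n / 4) ≤ ∑ w ∈ B, ((S.filter (fun u => (u, w) ∉ E)).card : ℝ) := by
      have := Finset.card_nsmul_le_sum B
        (fun w => ((S.filter (fun u => (u, w) ∉ E)).card : ℝ)) (n / 4)
        (fun w hw => (not_le.1 (Finset.mem_filter.1 hw).2).le)
      simpa using this
    have h4 : ∑ w ∈ B, ((S.filter (fun u => (u, w) ∉ E)).card : ℝ) ≤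
        ∑ w ∈ Y, ((S.filter (fun u => (u, w) ∉ E)).card : ℝ) :=
      Finset.sum_le_sum_of_subset_of_nonneg (Finset.filter_subset _ _)
        (fun _ _ _ => Nat.cast_nonneg _)
    have h5 : (S.card : ℝ) * (3 * (ε * n)) ≤ n * (3 * (ε * n)) := by gcongr
    have h6 : (B.card : ℝ) * (n / 4) ≤ (12 * (ε * n)) * (n / 4) := by linarith
    exact le_of_mul_le_mul_right h6 (by linarith)
  -- maximal matching among the edges touching a bad vertex
  set E' := E.filter (fun p => p.1 ∉ S ∨ p.2 ∉ Wg) with hE'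
  obtain ⟨M, hM, -⟩ := exists_maximal_ext E' ∅ ⟨by simp, by simp, by simp⟩
  have hME : IsMatching E M := ⟨hM.1.1.trans (Finset.filter_subset _ _), hM.1.2⟩
  set U1 := M.image Prod.fst with hU1
  set W1 := M.image Prod.snd with hW1
  have hU1' : ∀ u, u ∉ U1 → ∀ w, (u, w) ∉ M := fun u hu w h =>
    hu (Finset.mem_image.2 ⟨_, h, rfl⟩)
  have hW1' : ∀ w, w ∉ W1 → ∀ u, (u, w) ∉ M := fun w hw u h =>
    hw (Finset.mem_image.2 ⟨_, h, rfl⟩)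
  have hno : ∀ u w, u ∉ U1 → w ∉ W1 → (u ∉ S ∨ w ∉ Wg) → (u, w) ∉ E := by
    intro u w hu hw hor he
    exact maximal_no_edge E' M hM u w (hU1' u hu) (hW1' w hw) (Finset.mem_filter.2 ⟨he, hor⟩)
  -- sizes
  have hSU1 : ((S ∩ U1).card : ℝ) ≤ B.card := by
    have hsub : S ∩ U1 ⊆ (M.filter (fun p => p.2 ∈ B)).image Prod.fst := by
      intro u hu
      obtain ⟨huS, hu1⟩ := Finset.mem_inter.1 hu
      obtain ⟨⟨a, b⟩, hp, rfl⟩ := Finset.mem_image.1 hu1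
      have hpE := Finset.mem_filter.1 (hM.1.1 hp)
      have hbY : b ∈ Y := hNY a huS (by simpa [hN] using hpE.1)
      have hbW : b ∉ Wg := by
        rcases hpE.2 with h | h
        · exact absurd huS h
        · exact h
      refine Finset.mem_image.2 ⟨(a, b), Finset.mem_filter.2 ⟨hp, ?_⟩, rfl⟩
      exact Finset.mem_filter.2 ⟨hbY, fun h => hbW (Finset.mem_filter.2 ⟨hbY, h⟩)⟩
    have h1 := Finset.card_le_card hsub
    have h3 : (M.filter (fun p => p.2 ∈ B)).card ≤ B.card :=
      Finset.card_le_card_of_injOn Prod.snd (fun p hp => (Finset.mem_filter.1 hp).2)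
        (fun p hp q hq h => hME.2.2 p (Finset.mem_filter.1 hp).1 q (Finset.mem_filter.1 hq).1 h)
    exact_mod_cast h1.trans (Finset.card_image_le.trans h3)
  have hWW1 : ((Wg ∩ W1).card : ℝ) ≤ 3 * (ε * n) := by
    have hsub : Wg ∩ W1 ⊆ (M.filter (fun p => p.1 ∈ Sᶜ)).image Prod.snd := by
      intro w hw
      obtain ⟨hwg, hw1⟩ := Finset.mem_inter.1 hw
      obtain ⟨⟨a, b⟩, hp, rfl⟩ := Finset.mem_image.1 hw1
      have hpE := Finset.mem_filter.1 (hM.1.1 hp)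
      refine Finset.mem_image.2 ⟨(a, b), Finset.mem_filter.2 ⟨hp, ?_⟩, rfl⟩
      rcases hpE.2 with h | h
      · exact Finset.mem_compl.2 h
      · exact absurd hwg h
    have h1 := Finset.card_le_card hsub
    have h3 : (M.filter (fun p => p.1 ∈ Sᶜ)).card ≤ Sᶜ.card :=
      Finset.card_le_card_of_injOn Prod.fst (fun p hp => (Finset.mem_filter.1 hp).2)
        (fun p hp q hq h => hME.2.1 p (Finset.mem_filter.1 hp).1 q (Finset.mem_filter.1 hq).1 h)
    have h4 : ((Wg ∩ W1).card : ℝ) ≤ Sᶜ.card := by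
      exact_mod_cast h1.trans (Finset.card_image_le.trans h3)
    have h5 : (S.card : ℝ) + Sᶜ.card = n := by
      rw [← hU]; exact_mod_cast Finset.card_add_card_compl S
    linarith
  have hU2c : ((S \ U1).card : ℝ) + (S ∩ U1).card = S.card := by
    exact_mod_cast Finset.card_sdiff_add_card_inter S U1
  have hW2c : ((Wg \ W1).card : ℝ) + (Wg ∩ W1).card = Wg.card := by
    exact_mod_cast Finset.card_sdiff_add_card_inter Wg W1
  have hW2low : (n : ℝ) - 18 * (ε * n) ≤ (Wg \ W1).card := by linarith
  refine ⟨U1, S \ U1, Sᶜ \ U1, W1, Wg \ W1, Wgᶜ \ W1, Finset.disjoint_sdiff,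
    Finset.disjoint_sdiff, ?_, ?_, Finset.disjoint_sdiff, Finset.disjoint_sdiff, ?_, ?_, ?_,
    ⟨M, matching_perfect E M hME⟩, ?_, ?_, ?_, ?_, ?_⟩
  · rw [Finset.disjoint_left]; intro a; simp; tauto
  · ext a; simp; tauto
  · rw [Finset.disjoint_left]; intro a; simp only [Finset.mem_sdiff, Finset.mem_compl]; tauto
  · ext a; simp only [Finset.mem_union, Finset.mem_sdiff, Finset.mem_compl, Finset.mem_univ]; tauto
  · rw [hU1, hW1, matching_card_fst E M hME, matching_card_snd E M hME]
  · intro u hu w hw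
    obtain ⟨-, hu⟩ := Finset.mem_sdiff.1 hu
    obtain ⟨hwg, hw⟩ := Finset.mem_sdiff.1 hw
    exact hno u w hu hw (Or.inr (Finset.mem_compl.1 hwg))
  · intro u hu w hw
    obtain ⟨hus, hu⟩ := Finset.mem_sdiff.1 hu
    refine hno u w hu ?_ (Or.inl (Finset.mem_compl.1 hus))
    rcases Finset.mem_union.1 hw with h | h
    · exact (Finset.mem_sdiff.1 h).2
    · exact (Finset.mem_sdiff.1 h).2
  · nlinarith
  · have h0 : (0 : ℝ) ≤ (Wg ∩ W1).card := Nat.cast_nonneg _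
    have : ((Wg \ W1).card : ℝ) < (S \ U1).card := by linarith
    exact_mod_cast this
  · intro A hA hAc
    refine dense_perfect E A _ hAc (3 * (ε * n)) (n / 4) (by linarith) ?_ ?_
    · intro u hu
      refine le_trans ?_ (hmissU u (Finset.mem_sdiff.1 (hA hu)).1)
      have : Wg \ W1 ⊆ Y := Finset.sdiff_subset.trans (Finset.filter_subset _ _)
      exact_mod_cast Finset.card_le_card (Finset.filter_subset_filter _ this)
    · intro w hw
      refine le_trans ?_ (Finset.mem_filter.1 (Finset.mem_sdiff.1 hw).1).2
      have : A ⊆ S := hA.trans Finset.sdiff_subset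
      exact_mod_cast Finset.card_le_card (Finset.filter_subset_filter _ this)
end
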